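/- arXiv:1908.08266 — 3 statements merged into one kernel-verified Lean document; each statement's English description precedes it below -/
import Mathlib

section
/- Let k ∈ (1/√3, 1] be a real number and let A, p, g be finite strings over an alphabet such that A is a subsequence of p and of g, |A| ≥ k·|p| and |A| ≥ k·|g|. Then d(p, g) ≤ ((1 − k²)/k)·|p|, where d is the longest-common-subsequence edit distance. -/
/-- `lcsLen s t` is the maximum length of a common subsequence (`List.Sublist`)
of `s` and `t`. -/
noncomputable def lcsLen {α : Type*} (s t : List α) : ℕ :=
  sSup {n : ℕ | ∃ A : List α, A.Sublist s ∧ A.Sublist t ∧ A.length = n}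

/-- The longest-common-subsequence edit distance `d(s,t) = |s| + |t| − 2·ℓ(s,t)`. -/
noncomputable def lcsDist {α : Type*} (s t : List α) : ℤ :=
  (s.length : ℤ) + (t.length : ℤ) - 2 * (lcsLen s t : ℤ)

/-- paper's Lemma 2, corrected constant: for `k ∈ (1/√3, 1]`, if `A`
is a common subsequence of `p` and `g` with `|A| ≥ k·|p|` and `|A| ≥ k·|g|`, then
`d(p,g) ≤ ((1 − k²)/k)·|p|`. -/
theorem lcsDist_le_of_near_duplicate {α : Type*} (k : ℝ)
    (hk₁ : 1 / Real.sqrt 3 < k) (hk₂ : k ≤ 1) (A p g : List α)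
    (hAp : A.Sublist p) (hAg : A.Sublist g)
    (hkp : (A.length : ℝ) ≥ k * p.length)
    (hkg : (A.length : ℝ) ≥ k * g.length) :
    (lcsDist p g : ℝ) ≤ ((1 - k ^ 2) / k) * (p.length : ℝ) := by
  have hL : A.length ≤ lcsLen p g := by
    unfold lcsLen
    apply le_csSup
    · refine ⟨p.length, ?_⟩
      rintro n ⟨B, hB, -, rfl⟩
      exact hB.length_le
    · exact ⟨A, hAp, hAg, rfl⟩
  have hLr : (A.length : ℝ) ≤ (lcsLen p g : ℝ) := by exact_mod_cast hL
  have hs : Real.sqrt 3 < 2 := by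
    rw [Real.sqrt_lt' (by norm_num)]; norm_num
  have hs0 : 0 < Real.sqrt 3 := Real.sqrt_pos.mpr (by norm_num)
  have hk : 1 / 2 < k := lt_trans (one_div_lt_one_div_of_lt hs0 hs) hk₁
  have hk0 : 0 < k := by linarith
  have hp : (0 : ℝ) ≤ p.length := Nat.cast_nonneg _
  unfold lcsDist
  push_cast
  rw [div_mul_eq_mul_div, le_div_iff₀ hk0]
  have h1 := mul_le_mul_of_nonneg_left hLr hk0.le
  have h2 := mul_le_mul_of_nonneg_left hkp (show (0 : ℝ) ≤ 2 * k - 1 by linarith)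
  have h3 := mul_nonneg (sq_nonneg (1 - k)) hp
  nlinarith
end

section
/- Let k ∈ (1/√3, 1] be a real number and let p, g, fr be finite strings over an alphabet such that g is a subsequence of fr, k·|p| ≤ |g|, |fr| ≤ |p|/k, and d(g, p) ≤ (1 − k²)·|p|. Then d(fr, p) ≤ |p|·(1 + 1/k)·(1 − k²), where d is the longest-common-subsequence edit distance. -/
/-- core estimate of the paper's Lemma 3: for `k ∈ (1/√3, 1]`, if
`g` is a subsequence of the window `fr`, `k·|p| ≤ |g|`, `|fr| ≤ |p|/k`, and
`d(g,p) ≤ (1 − k²)·|p|`, then `d(fr,p) ≤ |p|·(1 + 1/k)·(1 − k²)`. -/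
theorem window_within_threshold {α : Type*} (k : ℝ)
    (hk₁ : 1 / Real.sqrt 3 < k) (hk₂ : k ≤ 1) (p g fr : List α)
    (hsub : g.Sublist fr)
    (hg : k * (p.length : ℝ) ≤ (g.length : ℝ))
    (hfr : (fr.length : ℝ) ≤ (p.length : ℝ) / k)
    (hd : (lcsDist g p : ℝ) ≤ (1 - k ^ 2) * (p.length : ℝ)) :
    (lcsDist fr p : ℝ) ≤ (p.length : ℝ) * (1 + 1 / k) * (1 - k ^ 2) := by
  have hk : 0 < k := lt_trans (by positivity) hk₁
  have hl : lcsLen g p ≤ lcsLen fr p := by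
    unfold lcsLen
    apply csSup_le_csSup
    · refine ⟨p.length, ?_⟩
      rintro n ⟨A, _, h, rfl⟩
      exact h.length_le
    · exact ⟨0, [], List.nil_sublist _, List.nil_sublist _, rfl⟩
    · rintro n ⟨A, h1, h2, h3⟩
      exact ⟨A, h1.trans hsub, h2, h3⟩
  have hl' : (lcsLen g p : ℝ) ≤ (lcsLen fr p : ℝ) := by exact_mod_cast hl
  unfold lcsDist at hd ⊢
  push_cast at hd ⊢
  have e : (p.length : ℝ) * (1 + 1 / k) * (1 - k ^ 2)
      = (1 - k ^ 2) * (p.length : ℝ) + (p.length : ℝ) / k - k * (p.length : ℝ) := by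
    field_simp
    ring
  rw [e]
  linarith
end

section
/- Let D be a finite string over an alphabet, and for natural numbers i, L let window(i) denote the contiguous fragment of D of length L starting at position i (i.e., (D.drop i).take L), where i + s + L ≤ |D|. Then d(window(i), window(i+s)) ≤ 2·s, and consequently, for every string p, d(window(i+s), p) ≥ d(window(i), p) − 2·s, where d is the longest-common-subsequence edit distance. -/
theorem lcsLen_bdd {α : Type*} (s t : List α) :
    BddAbove {n : ℕ | ∃ A : List α, A.Sublist s ∧ A.Sublist t ∧ A.length = n} := by
  refine ⟨s.length, ?_⟩
  rintro n ⟨A, h1, _, rfl⟩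
  exact h1.length_le

theorem le_lcsLen {α : Type*} {s t A : List α} (h1 : A.Sublist s) (h2 : A.Sublist t) :
    A.length ≤ lcsLen s t :=
  le_csSup (lcsLen_bdd s t) ⟨A, h1, h2, rfl⟩

theorem exists_lcs {α : Type*} (s t : List α) :
    ∃ A : List α, A.Sublist s ∧ A.Sublist t ∧ A.length = lcsLen s t :=
  Nat.sSup_mem (s := {n : ℕ | ∃ A : List α, A.Sublist s ∧ A.Sublist t ∧ A.length = n})
    ⟨0, [], List.nil_sublist _, List.nil_sublist _, rfl⟩ (lcsLen_bdd s t)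

/-- justification of Optimization 1, window skipping: shifting a
window of length `L` in the document `D` by `s` positions changes nothing by
more than `2·s` in LCS edit distance; consequently the distance to any pattern
`p` decreases by at most `2·s`. -/
theorem window_shift_bound {α : Type*} (D : List α) (i s L : ℕ)
    (h : i + s + L ≤ D.length) :
    lcsDist ((D.drop i).take L) ((D.drop (i + s)).take L) ≤ 2 * (s : ℤ) ∧
    ∀ p : List α,
      lcsDist ((D.drop (i + s)).take L) p ≥ lcsDist ((D.drop i).take L) p - 2 * (s : ℤ) := by
  have hC1 : ((D.drop (i + s)).take (L - s)).Sublist ((D.drop i).take L) := by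
    have e : (D.drop (i + s)).take (L - s) = ((D.drop i).take L).drop s := by
      rw [List.drop_take, List.drop_drop]
    rw [e]
    exact List.drop_sublist _ _
  have hC2 : ((D.drop (i + s)).take (L - s)).Sublist ((D.drop (i + s)).take L) :=
    (List.take_prefix_take_left (by omega)).sublist
  have l1 : ((D.drop i).take L).length = L := by
    rw [List.length_take, List.length_drop]; omega
  have l2 : ((D.drop (i + s)).take L).length = L := by
    rw [List.length_take, List.length_drop]; omega
  have l3 : ((D.drop (i + s)).take (L - s)).length = L - s := by
    rw [List.length_take, List.length_drop]; omega
  constructor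
  · have := le_lcsLen hC1 hC2
    unfold lcsDist
    omega
  · intro p
    obtain ⟨A, hA, hp, hl⟩ := exists_lcs ((D.drop (i + s)).take L) p
    have e : (D.drop (i + s)).take L =
        (D.drop (i + s)).take (L - s) ++ ((D.drop (i + s)).take L).drop (L - s) := by
      conv_lhs => rw [← List.take_append_drop (L - s) ((D.drop (i + s)).take L)]
      rw [List.take_take, min_eq_left (by omega)]
    rw [e] at hA
    obtain ⟨A1, A2, rfl, h1, h2⟩ := List.sublist_append_iff.1 hA
    have b1 := le_lcsLen (h1.trans hC1) ((List.sublist_append_left A1 A2).trans hp)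
    have b2 := h2.length_le
    rw [List.length_drop, l2] at b2
    rw [List.length_append] at hl
    unfold lcsDist
    omega
end
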